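/- arXiv:0901.1418 — 9 statements merged into one kernel-verified Lean document; each statement's English description precedes it below -/
import Mathlib

section
/- Under Assumptions (I) and (II), if the limit d_k = lim_{t→∞} d_{k,t} exists for every k and Σ_{k=0}^∞ d_k = 1, then the steady degree distribution P(k) satisfies the recursion: P(0) = F⁻(1)P(1)/(1+F⁺(0)) + d_0/(1+F⁺(0)), and for every k > 0, P(k) = F⁺(k−1)P(k−1)/(1+F⁺(k)+F⁻(k)) + F⁻(k+1)P(k+1)/(1+F⁺(k)+F⁻(k)) + d_k/(1+F⁺(k)+F⁻(k)). -/
open Filter Topology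

/-- If a sequence has convergent increments and converges after division by `t`,
then the two limits agree. -/
lemma eq_of_tendsto_increment {S : ℕ → ℝ} {p L : ℝ}
    (hS : Tendsto (fun t : ℕ => (1 / (t : ℝ)) * S t) atTop (𝓝 p))
    (hL : Tendsto (fun t : ℕ => S (t + 1) - S t) atTop (𝓝 L)) : p = L := by
  have h := hL.cesaro
  simp only [Finset.sum_range_sub] at h
  have h0 : Tendsto (fun t : ℕ => (t : ℝ)⁻¹ * S 0) atTop (𝓝 0) := by
    simpa using (tendsto_inv_atTop_nhds_zero_nat (𝕜 := ℝ)).mul_const (S 0)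
  refine tendsto_nhds_unique hS ?_
  simpa [mul_sub] using h.add h0

/-- Limiting balance equation for an average over start times `i ≤ t` of quantities `q i t`
that decay at rate `a t` and receive an inflow `r i t`. -/
lemma average_balance {q r : ℕ → ℕ → ℝ} {a δ : ℕ → ℝ} {p A D R : ℝ}
    (hq : ∀ i, 1 ≤ i → ∀ t, i ≤ t → q i (t + 1) = q i t * (1 - a t) + r i t)
    (hinit : ∀ i, 1 ≤ i → q i i = δ i)
    (hδ : Tendsto δ atTop (𝓝 D))
    (ha : Tendsto (fun t : ℕ => (t : ℝ) * a t) atTop (𝓝 A))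
    (hr : Tendsto (fun t : ℕ => ∑ i ∈ Finset.Icc 1 t, r i t) atTop (𝓝 R))
    (hp : Tendsto (fun t : ℕ => (1 / (t : ℝ)) * ∑ i ∈ Finset.Icc 1 t, q i t) atTop (𝓝 p)) :
    p = D - A * p + R := by
  refine eq_of_tendsto_increment hp ?_
  refine Tendsto.congr' ?_ ((((tendsto_add_atTop_iff_nat 1).2 hδ).sub (ha.mul hp)).add hr)
  filter_upwards [eventually_ge_atTop 1] with t ht
  have ht0 : (t : ℝ) ≠ 0 := by positivity
  have hsum : ∑ i ∈ Finset.Icc 1 t, q i (t + 1)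
      = (∑ i ∈ Finset.Icc 1 t, q i t) * (1 - a t) + ∑ i ∈ Finset.Icc 1 t, r i t := by
    rw [Finset.sum_mul, ← Finset.sum_add_distrib]
    refine Finset.sum_congr rfl fun i hi => ?_
    rw [Finset.mem_Icc] at hi
    exact hq i hi.1 t hi.2
  rw [Finset.sum_Icc_succ_top (by lia), hsum, hinit (t + 1) (by lia)]
  field_simp
  ring

/-- Under Assumptions (I) and (II), if `d_k = lim_t d_{k,t}` exists for
every `k` and `∑ d_k = 1`, then the steady degree distribution `P` satisfies the
stated recursion. -/
theorem degree_distribution_recursion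
    (fp fm : ℕ → ℕ → ℝ)        -- fp t k = f_t⁺(k), fm t k = f_t⁻(k)
    (dkt : ℕ → ℕ → ℝ)          -- dkt k t = d_{k,t}
    (Pkit : ℕ → ℕ → ℕ → ℝ)     -- Pkit k i t = P(k,i,t)
    (hfp_pos : ∀ t, 1 ≤ t → ∀ k, 0 < fp t k)
    (hfm_pos : ∀ t, 1 ≤ t → ∀ k, 1 ≤ k → 0 < fm t k)
    (hfm_zero : ∀ t, 1 ≤ t → fm t 0 = 0)
    (hfsum : ∀ t, 1 ≤ t → ∀ k, fp t k + fm t k ≤ 1)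
    (hinit : ∀ k, ∀ i, 1 ≤ i → Pkit k i i = dkt k i)
    (hrec0 : ∀ i, 1 ≤ i → ∀ t, i ≤ t →
      Pkit 0 i (t + 1)
        = Pkit 0 i t * (1 - fp t 0 - fm t 0) + Pkit 1 i t * fm t 1)
    (hrec : ∀ k, 1 ≤ k → ∀ i, 1 ≤ i → ∀ t, i ≤ t →
      Pkit k i (t + 1)
        = Pkit k i t * (1 - fp t k - fm t k)
          + Pkit (k - 1) i t * fp t (k - 1)
          + Pkit (k + 1) i t * fm t (k + 1))
    (Pkt : ℕ → ℕ → ℝ)          -- Pkt k t = P(k,t)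
    (hPkt : ∀ k, ∀ t, 1 ≤ t →
      Pkt k t = (1 / (t : ℝ)) * ∑ i ∈ Finset.Icc 1 t, Pkit k i t)
    -- Assumption (I)
    (Fp Fm : ℕ → ℝ)
    (hFp : ∀ k, Tendsto (fun t : ℕ => (t : ℝ) * fp t k) atTop (𝓝 (Fp k)))
    (hFm : ∀ k, Tendsto (fun t : ℕ => (t : ℝ) * fm t k) atTop (𝓝 (Fm k)))
    -- Assumption (II)
    (P : ℕ → ℝ)
    (hP : ∀ k, Tendsto (fun t : ℕ => Pkt k t) atTop (𝓝 (P k)))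
    -- existence of d_k = lim_t d_{k,t} with ∑ d_k = 1
    (d : ℕ → ℝ)
    (hd : ∀ k, Tendsto (fun t : ℕ => dkt k t) atTop (𝓝 (d k)))
    (hdsum : ∑' k : ℕ, d k = 1) :
    P 0 = Fm 1 / (1 + Fp 0) * P 1 + d 0 / (1 + Fp 0) ∧
    ∀ k, 1 ≤ k →
      P k = Fp (k - 1) / (1 + Fp k + Fm k) * P (k - 1)
        + Fm (k + 1) / (1 + Fp k + Fm k) * P (k + 1)
        + d k / (1 + Fp k + Fm k) := by
  have havg : ∀ k, Tendsto
      (fun t : ℕ => (1 / (t : ℝ)) * ∑ i ∈ Finset.Icc 1 t, Pkit k i t) atTop (𝓝 (P k)) := by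
    intro k
    refine (hP k).congr' ?_
    filter_upwards [eventually_ge_atTop 1] with t ht using hPkt k t ht
  have hflow : ∀ k (f : ℕ → ℝ) (F : ℝ), Tendsto (fun t : ℕ => (t : ℝ) * f t) atTop (𝓝 F) →
      Tendsto (fun t : ℕ => ∑ i ∈ Finset.Icc 1 t, Pkit k i t * f t) atTop (𝓝 (F * P k)) := by
    intro k f F hf
    refine (hf.mul (havg k)).congr' ?_
    filter_upwards [eventually_ge_atTop 1] with t ht
    have ht0 : (t : ℝ) ≠ 0 := by positivity
    rw [← Finset.sum_mul]
    field_simp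
  have hFp_nonneg : ∀ k, 0 ≤ Fp k := by
    intro k
    refine ge_of_tendsto (hFp k) ?_
    filter_upwards [eventually_ge_atTop 1] with t ht
    exact mul_nonneg t.cast_nonneg (hfp_pos t ht k).le
  have hFm_zero : Fm 0 = 0 := by
    refine tendsto_nhds_unique (hFm 0) (tendsto_const_nhds.congr' ?_)
    filter_upwards [eventually_ge_atTop 1] with t ht
    rw [hfm_zero t ht, mul_zero]
  have hFm_nonneg : ∀ k, 1 ≤ k → 0 ≤ Fm k := by
    intro k hk
    refine ge_of_tendsto (hFm k) ?_
    filter_upwards [eventually_ge_atTop 1] with t ht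
    exact mul_nonneg t.cast_nonneg (hfm_pos t ht k hk).le
  have hout : ∀ k, Tendsto (fun t : ℕ => (t : ℝ) * (fp t k + fm t k)) atTop
      (𝓝 (Fp k + Fm k)) := by
    intro k
    simpa only [mul_add] using (hFp k).add (hFm k)
  constructor
  · have h := average_balance (q := Pkit 0) (a := fun t => fp t 0 + fm t 0)
      (r := fun i t => Pkit 1 i t * fm t 1)
      (fun i hi t hit => by rw [hrec0 i hi t hit]; ring)
      (hinit 0) (hd 0) (hout 0) (hflow 1 _ _ (hFm 1)) (havg 0)
    rw [hFm_zero] at h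
    have hpos : 1 + Fp 0 ≠ 0 := by
      have := hFp_nonneg 0
      positivity
    field_simp
    linarith
  · intro k hk
    have hin : Tendsto (fun t : ℕ => ∑ i ∈ Finset.Icc 1 t,
        (Pkit (k - 1) i t * fp t (k - 1) + Pkit (k + 1) i t * fm t (k + 1))) atTop
        (𝓝 (Fp (k - 1) * P (k - 1) + Fm (k + 1) * P (k + 1))) := by
      simpa only [Finset.sum_add_distrib] using
        (hflow (k - 1) _ _ (hFp (k - 1))).add (hflow (k + 1) _ _ (hFm (k + 1)))
    have h := average_balance (q := Pkit k) (a := fun t => fp t k + fm t k)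
      (fun i hi t hit => by rw [hrec k hk i hi t hit]; ring)
      (hinit k) (hd k) (hout k) hin (havg k)
    have hpos : 1 + Fp k + Fm k ≠ 0 := by
      have := hFp_nonneg k
      have := hFm_nonneg k hk
      positivity
    field_simp
    linarith
end

section
/- Under Assumptions (I) and (II), if the limit d_k = lim_{t→∞} d_{k,t} exists for every k with Σ_{k=0}^∞ d_k = 1, and if there are constants A, B, Ā, B̄ such that F⁺(k) = A·k + B and F⁻(k) = Ā·k + B̄ for all k ≥ 1 with F⁻(0) = 0, then P(0) = (Ā+B̄)P(1)/(1+B) + d_0/(1+B), and for every k > 0, P(k) = (A(k−1)+B)P(k−1)/(1+Ak+B+Āk+B̄) + (Ā(k+1)+B̄)P(k+1)/(1+Ak+B+Āk+B̄) + d_k/(1+Ak+B+Āk+B̄). -/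
open Filter Topology

/-- If the increments of `s` converge to `c` and `s t / t` converges to `p`, then `p = c`. -/
lemma eq_of_tendsto_increment_of_tendsto_average {s : ℕ → ℝ} {c p : ℝ} (h0 : s 0 = 0)
    (hinc : Tendsto (fun t => s (t + 1) - s t) atTop (𝓝 c))
    (hs : Tendsto (fun t : ℕ => 1 / (t : ℝ) * s t) atTop (𝓝 p)) : p = c := by
  have h := hinc.cesaro
  simp only [Finset.sum_range_sub, h0, sub_zero, ← one_div] at h
  exact tendsto_nhds_unique hs h

/-- If `s t / t` converges to `p` and `t * f t` converges to `F`, then `s t * f t` converges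
to `p * F`. -/
lemma tendsto_mul_of_tendsto_average {s f : ℕ → ℝ} {p F : ℝ}
    (hs : Tendsto (fun t : ℕ => 1 / (t : ℝ) * s t) atTop (𝓝 p))
    (hf : Tendsto (fun t : ℕ => (t : ℝ) * f t) atTop (𝓝 F)) :
    Tendsto (fun t => s t * f t) atTop (𝓝 (p * F)) := by
  refine (hs.mul hf).congr' ?_
  filter_upwards [eventually_ge_atTop 1] with t ht
  have : (t : ℝ) ≠ 0 := by positivity
  field_simp

/-- Under Assumptions (I) and (II), if `d_k = lim_t d_{k,t}` exists with
`∑ d_k = 1` and `F⁺(k) = A k + B`, `F⁻(k) = Ā k + B̄` for `k ≥ 1` (with `F⁻(0) = 0`),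
then `P` satisfies the stated linear-rate recursion. -/
theorem degree_distribution_recursion_linear
    (fp fm : ℕ → ℕ → ℝ)        -- fp t k = f_t⁺(k), fm t k = f_t⁻(k)
    (dkt : ℕ → ℕ → ℝ)          -- dkt k t = d_{k,t}
    (Pkit : ℕ → ℕ → ℕ → ℝ)     -- Pkit k i t = P(k,i,t)
    (hfp_pos : ∀ t, 1 ≤ t → ∀ k, 0 < fp t k)
    (hfm_pos : ∀ t, 1 ≤ t → ∀ k, 1 ≤ k → 0 < fm t k)
    (hfm_zero : ∀ t, 1 ≤ t → fm t 0 = 0)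
    (hfsum : ∀ t, 1 ≤ t → ∀ k, fp t k + fm t k ≤ 1)
    (hinit : ∀ k, ∀ i, 1 ≤ i → Pkit k i i = dkt k i)
    (hrec0 : ∀ i, 1 ≤ i → ∀ t, i ≤ t →
      Pkit 0 i (t + 1)
        = Pkit 0 i t * (1 - fp t 0 - fm t 0) + Pkit 1 i t * fm t 1)
    (hrec : ∀ k, 1 ≤ k → ∀ i, 1 ≤ i → ∀ t, i ≤ t →
      Pkit k i (t + 1)
        = Pkit k i t * (1 - fp t k - fm t k)
          + Pkit (k - 1) i t * fp t (k - 1)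
          + Pkit (k + 1) i t * fm t (k + 1))
    (Pkt : ℕ → ℕ → ℝ)          -- Pkt k t = P(k,t)
    (hPkt : ∀ k, ∀ t, 1 ≤ t →
      Pkt k t = (1 / (t : ℝ)) * ∑ i ∈ Finset.Icc 1 t, Pkit k i t)
    -- Assumption (I)
    (Fp Fm : ℕ → ℝ)
    (hFp : ∀ k, Tendsto (fun t : ℕ => (t : ℝ) * fp t k) atTop (𝓝 (Fp k)))
    (hFm : ∀ k, Tendsto (fun t : ℕ => (t : ℝ) * fm t k) atTop (𝓝 (Fm k)))
    -- Assumption (II)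
    (P : ℕ → ℝ)
    (hP : ∀ k, Tendsto (fun t : ℕ => Pkt k t) atTop (𝓝 (P k)))
    -- existence of d_k = lim_t d_{k,t} with ∑ d_k = 1
    (d : ℕ → ℝ)
    (hd : ∀ k, Tendsto (fun t : ℕ => dkt k t) atTop (𝓝 (d k)))
    (hdsum : ∑' k : ℕ, d k = 1)
    -- linear rates
    (A B Abar Bbar : ℝ)
    (hFp_lin : ∀ k : ℕ, 1 ≤ k → Fp k = A * k + B)
    (hFp0 : Fp 0 = B)
    (hFm_lin : ∀ k : ℕ, 1 ≤ k → Fm k = Abar * k + Bbar)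
    (hFm0 : Fm 0 = 0) :
    P 0 = (Abar + Bbar) / (1 + B) * P 1 + d 0 / (1 + B) ∧
    ∀ k : ℕ, 1 ≤ k →
      P k = (A * ((k : ℝ) - 1) + B) / (1 + A * k + B + Abar * k + Bbar) * P (k - 1)
        + (Abar * ((k : ℝ) + 1) + Bbar) / (1 + A * k + B + Abar * k + Bbar) * P (k + 1)
        + d k / (1 + A * k + B + Abar * k + Bbar) := by
  have h_avg : ∀ k, Tendsto (fun t : ℕ => 1 / (t : ℝ) * ∑ i ∈ Finset.Icc 1 t, Pkit k i t)
      atTop (𝓝 (P k)) := fun k => (hP k).congr' <| by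
    filter_upwards [eventually_ge_atTop 1] with t ht using hPkt k t ht
  have h_up := fun k l => tendsto_mul_of_tendsto_average (h_avg k) (hFp l)
  have h_down := fun k l => tendsto_mul_of_tendsto_average (h_avg k) (hFm l)
  have h_new := fun k => (tendsto_add_atTop_iff_nat 1).2 (hd k)
  have h_split : ∀ k t, ∑ i ∈ Finset.Icc 1 (t + 1), Pkit k i (t + 1)
      = ∑ i ∈ Finset.Icc 1 t, Pkit k i (t + 1) + dkt k (t + 1) := fun k t => by
    rw [Finset.sum_Icc_succ_top (by omega), hinit k (t + 1) (by omega)]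
  have hFp_nonneg : ∀ k, 0 ≤ Fp k := fun k => ge_of_tendsto (hFp k) <| by
    filter_upwards [eventually_ge_atTop 1] with t ht
    exact mul_nonneg t.cast_nonneg (hfp_pos t ht k).le
  have hFm_nonneg : ∀ k, 1 ≤ k → 0 ≤ Fm k := fun k hk => ge_of_tendsto (hFm k) <| by
    filter_upwards [eventually_ge_atTop 1] with t ht
    exact mul_nonneg t.cast_nonneg (hfm_pos t ht k hk).le
  have hFp_all : ∀ k : ℕ, Fp k = A * k + B := fun k => by
    rcases Nat.eq_zero_or_pos k with rfl | hk
    · simpa using hFp0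
    · exact hFp_lin k hk
  constructor
  · have h_bal : P 0 = -(P 0 * Fp 0) - P 0 * Fm 0 + P 1 * Fm 1 + d 0 := by
      refine eq_of_tendsto_increment_of_tendsto_average (by simp) ?_ (h_avg 0)
      refine ((((h_up 0 0).neg.sub (h_down 0 0)).add (h_down 1 1)).add (h_new 0)).congr fun t => ?_
      rw [h_split, Finset.sum_congr rfl fun i hi =>
        hrec0 i (Finset.mem_Icc.1 hi).1 t (Finset.mem_Icc.1 hi).2]
      simp only [Finset.sum_add_distrib, ← Finset.sum_mul]
      ring
    have hB : 0 ≤ B := hFp0 ▸ hFp_nonneg 0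
    have hB' : 1 + B ≠ 0 := by positivity
    rw [hFp0, hFm0, hFm_lin 1 le_rfl] at h_bal
    push_cast at h_bal
    field_simp
    linarith
  · intro k hk
    have h_bal : P k = -(P k * Fp k) - P k * Fm k + P (k - 1) * Fp (k - 1)
        + P (k + 1) * Fm (k + 1) + d k := by
      refine eq_of_tendsto_increment_of_tendsto_average (by simp) ?_ (h_avg k)
      refine (((((h_up k k).neg.sub (h_down k k)).add (h_up (k - 1) (k - 1))).add
        (h_down (k + 1) (k + 1))).add (h_new k)).congr fun t => ?_
      rw [h_split, Finset.sum_congr rfl fun i hi =>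
        hrec k hk i (Finset.mem_Icc.1 hi).1 t (Finset.mem_Icc.1 hi).2]
      simp only [Finset.sum_add_distrib, ← Finset.sum_mul]
      ring
    have h_den : 1 + A * k + B + Abar * k + Bbar ≠ 0 := by
      have h₁ := hFp_nonneg k
      have h₂ := hFm_nonneg k hk
      rw [hFp_all] at h₁
      rw [hFm_lin k hk] at h₂
      linarith
    rw [hFp_all, hFp_all, hFm_lin k hk, hFm_lin (k + 1) (by omega), Nat.cast_sub hk] at h_bal
    push_cast at h_bal
    rw [div_mul_eq_mul_div, div_mul_eq_mul_div, ← add_div, ← add_div, eq_div_iff h_den]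
    linarith
end

section
/- Let A > 0, B ≥ 0, B̄ ∈ ℝ, C ∈ ℝ, and define P(k) = C·∫₀¹ z^{k−1+B/A}·(1−z)^{1/A}·e^{−(B̄/A)·z} dz for integers k ≥ 1. Then for every integer k with k − 1 + B/A > 0, P satisfies the recurrence (1 + A·k + B + B̄)·P(k) = (A(k−1)+B)·P(k−1) + B̄·P(k+1). -/
open intervalIntegral

/-- The integrand `z ^ s * (1 - z) ^ c * exp (-b z)` is integrable on `[0, 1]` for `s > -1`,
`c ≥ 0`. -/
lemma intervalIntegrable_rpow_mul_one_sub_rpow_mul_exp {s c : ℝ} (b : ℝ) (hs : -1 < s)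
    (hc : 0 ≤ c) :
    IntervalIntegrable (fun z : ℝ => z ^ s * (1 - z) ^ c * Real.exp (-b * z))
      MeasureTheory.volume 0 1 := by
  have h1 : Continuous fun z : ℝ => (1 - z) ^ c :=
    (continuous_const.sub continuous_id).rpow_const fun _ => Or.inr hc
  have h2 : Continuous fun z : ℝ => Real.exp (-b * z) := by fun_prop
  exact ((intervalIntegral.intervalIntegrable_rpow' hs).mul_continuousOn h1.continuousOn).mul_continuousOn
    h2.continuousOn

/-- The contiguity relation obtained by integrating the derivative of
`z ^ a * (1 - z) ^ (c + 1) * exp (-b z)` over `[0, 1]`. -/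
lemma integral_rpow_mul_one_sub_rpow_mul_exp_contiguous {a c : ℝ} (b : ℝ) (ha : 0 < a)
    (hc : 0 ≤ c) :
    (a + c + 1 + b) * ∫ z in (0:ℝ)..1, z ^ a * (1 - z) ^ c * Real.exp (-b * z)
      = a * (∫ z in (0:ℝ)..1, z ^ (a - 1) * (1 - z) ^ c * Real.exp (-b * z))
        + b * ∫ z in (0:ℝ)..1, z ^ (a + 1) * (1 - z) ^ c * Real.exp (-b * z) := by
  have i0 := (intervalIntegrable_rpow_mul_one_sub_rpow_mul_exp b
    (by linarith : -1 < a - 1) hc).const_mul a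
  have i1 := (intervalIntegrable_rpow_mul_one_sub_rpow_mul_exp b
    (by linarith : -1 < a) hc).const_mul (a + c + 1 + b)
  have i2 := (intervalIntegrable_rpow_mul_one_sub_rpow_mul_exp b
    (by linarith : -1 < a + 1) hc).const_mul b
  have hcont : Continuous fun z : ℝ => z ^ a * (1 - z) ^ (c + 1) * Real.exp (-b * z) :=
    ((continuous_id.rpow_const fun _ => Or.inr ha.le).mul
      ((continuous_const.sub continuous_id).rpow_const fun _ => Or.inr (by linarith))).mul
      (by fun_prop)
  have key := intervalIntegral.integral_eq_sub_of_hasDerivAt_of_le zero_le_one hcont.continuousOn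
    (fun z hz => ?_) ((i0.add i2).sub i1)
  · rw [integral_sub (i0.add i2) i1, integral_add i0 i2, integral_const_mul, integral_const_mul,
      integral_const_mul, sub_self, Real.zero_rpow (by linarith : c + 1 ≠ 0),
      Real.zero_rpow ha.ne'] at key
    linarith
  · have hz0 : 0 < z := hz.1
    have hz1 : 0 < 1 - z := sub_pos.2 hz.2
    have d1 := (hasDerivAt_id z).rpow_const (p := a) (Or.inl hz0.ne')
    have d2 := ((hasDerivAt_id z).const_sub 1).rpow_const (p := c + 1) (Or.inl hz1.ne')
    have d3 := ((hasDerivAt_id z).const_mul (-b)).exp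
    refine ((d1.mul d2).mul d3).congr_deriv ?_
    have e1 : z ^ a = z ^ (a - 1) * z := by
      rw [← Real.rpow_add_one hz0.ne', sub_add_cancel]
    simp only [id, Pi.mul_apply, add_sub_cancel_right,
      Real.rpow_add_one hz0.ne', Real.rpow_add_one hz1.ne', e1]
    ring

/-- case Ā = 0, A ≠ 0: the integral formula
`P(k) = C ∫₀¹ z^{k−1+B/A} (1−z)^{1/A} e^{−(B̄/A)z} dz` satisfies the steady-state
recurrence `(1 + Ak + B + B̄) P(k) = (A(k−1)+B) P(k−1) + B̄ P(k+1)` whenever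
`k − 1 + B/A > 0`. -/
theorem integral_solution_Abar_zero
    (A B Bbar C : ℝ) (hA : 0 < A) (hB : 0 ≤ B)
    (P : ℕ → ℝ)
    (hP : ∀ k : ℕ, P k
      = C * ∫ z in (0:ℝ)..1,
          z ^ ((k : ℝ) - 1 + B / A) * (1 - z) ^ (1 / A)
            * Real.exp (-(Bbar / A) * z)) :
    ∀ k : ℕ, 1 ≤ k → 0 < (k : ℝ) - 1 + B / A →
      (1 + A * k + B + Bbar) * P k
        = (A * ((k : ℝ) - 1) + B) * P (k - 1) + Bbar * P (k + 1) := by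
  intro k hk ha
  have h := integral_rpow_mul_one_sub_rpow_mul_exp_contiguous (Bbar / A) ha
    (one_div_pos.2 hA).le
  have e0 : ((k - 1 : ℕ) : ℝ) - 1 + B / A = (k : ℝ) - 1 + B / A - 1 := by
    push_cast [Nat.cast_sub hk]; ring
  have e2 : ((k + 1 : ℕ) : ℝ) - 1 + B / A = (k : ℝ) - 1 + B / A + 1 := by
    push_cast; ring
  have c1 : 1 + A * k + B + Bbar = A * ((k : ℝ) - 1 + B / A + 1 / A + 1 + Bbar / A) := by
    field_simp; ring
  have c0 : A * ((k : ℝ) - 1) + B = A * ((k : ℝ) - 1 + B / A) := by field_simp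
  have c2 : Bbar = A * (Bbar / A) := by field_simp
  rw [hP k, hP (k - 1), hP (k + 1), e0, e2, c1, c0]
  linear_combination (A * C) * h +
    (-C * ∫ z in (0:ℝ)..1, z ^ ((k : ℝ) - 1 + B / A + 1) * (1 - z) ^ (1 / A)
      * Real.exp (-(Bbar / A) * z)) * c2
end

section
/- Let A > Ā > 0, B ≥ 0, B̄ ∈ ℝ, C ∈ ℝ, and define P(k) = C·∫₀¹ z^{k−1+B/A}·(1−z)^{1/(A−Ā)}·(A/Ā − z)^{B̄/Ā − 1/(A−Ā) − B/A} dz for integers k ≥ 1. Then for every integer k with k − 1 + B/A > 0, P satisfies the recurrence (1 + (A+Ā)·k + B + B̄)·P(k) = (A(k−1)+B)·P(k−1) + (Ā(k+1)+B̄)·P(k+1). -/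
open intervalIntegral

/-- The integrand `z ^ s (1 - z) ^ c (r - z) ^ d` is integrable on `[0, 1]`. -/
lemma intervalIntegrable_rpow_mul_one_sub_rpow_mul_sub_rpow {s c r : ℝ} (d : ℝ) (hs : -1 < s)
    (hc : 0 ≤ c) (hr : 1 < r) :
    IntervalIntegrable (fun z : ℝ => z ^ s * (1 - z) ^ c * (r - z) ^ d)
      MeasureTheory.volume 0 1 := by
  refine ((intervalIntegrable_rpow' hs).mul_continuousOn ?_).mul_continuousOn ?_
  · exact (continuousOn_const.sub continuousOn_id).rpow_const fun z _ => Or.inr hc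
  · refine (continuousOn_const.sub continuousOn_id).rpow_const fun z hz => Or.inl ?_
    rw [Set.uIcc_of_le zero_le_one] at hz
    exact (sub_pos.2 (hz.2.trans_lt hr)).ne'

/-- Contiguity relation for Euler-type integrals, obtained by integrating the derivative of
`z ^ a (1 - z) ^ (c + 1) (r - z) ^ (d + 1)` over `[0, 1]`. -/
lemma integral_rpow_mul_one_sub_rpow_mul_sub_rpow_contiguous {a c r : ℝ} (d : ℝ) (ha : 0 < a)
    (hc : 0 ≤ c) (hr : 1 < r) :
    (a * (1 + r) + (c + 1) * r + (d + 1)) *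
        ∫ z in (0:ℝ)..1, z ^ a * (1 - z) ^ c * (r - z) ^ d
      = a * r * (∫ z in (0:ℝ)..1, z ^ (a - 1) * (1 - z) ^ c * (r - z) ^ d)
        + (a + c + d + 2) * ∫ z in (0:ℝ)..1, z ^ (a + 1) * (1 - z) ^ c * (r - z) ^ d := by
  have h0 := (intervalIntegrable_rpow_mul_one_sub_rpow_mul_sub_rpow (s := a - 1) d
    (by linarith) hc hr).const_mul (a * r)
  have h1 := (intervalIntegrable_rpow_mul_one_sub_rpow_mul_sub_rpow (s := a) d
    (by linarith) hc hr).const_mul (a * (1 + r) + (c + 1) * r + (d + 1))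
  have h2 := (intervalIntegrable_rpow_mul_one_sub_rpow_mul_sub_rpow (s := a + 1) d
    (by linarith) hc hr).const_mul (a + c + d + 2)
  have key := integral_eq_sub_of_hasDerivAt_of_le
    (f := fun z : ℝ => z ^ a * (1 - z) ^ (c + 1) * (r - z) ^ (d + 1))
    zero_le_one ?_ ?_ ((h0.add h2).sub h1)
  · rw [integral_sub (h0.add h2) h1, integral_add h0 h2, integral_const_mul, integral_const_mul,
      integral_const_mul, sub_self, Real.zero_rpow ha.ne',
      Real.zero_rpow (by linarith : c + 1 ≠ 0)] at key
    linarith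
  · refine ((continuousOn_id.rpow_const fun z _ => Or.inr ha.le).mul
      ((continuousOn_const.sub continuousOn_id).rpow_const fun z _ => Or.inr (by linarith))).mul
      ((continuousOn_const.sub continuousOn_id).rpow_const fun z hz => Or.inl ?_)
    exact (sub_pos.2 (hz.2.trans_lt hr)).ne'
  · rintro z ⟨hz0, hz1⟩
    have hz1' : 0 < 1 - z := sub_pos.2 hz1
    have hzr : 0 < r - z := sub_pos.2 (hz1.trans hr)
    have e1 := (hasDerivAt_id z).rpow_const (p := a) (Or.inl hz0.ne')
    have e2 := ((hasDerivAt_id z).const_sub 1).rpow_const (p := c + 1) (Or.inl hz1'.ne')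
    have e3 := ((hasDerivAt_id z).const_sub r).rpow_const (p := d + 1) (Or.inl hzr.ne')
    refine ((e1.mul e2).mul e3).congr_deriv ?_
    have hza : z ^ a = z ^ (a - 1) * z := by
      rw [← Real.rpow_add_one hz0.ne', sub_add_cancel]
    simp only [Pi.mul_apply, id, add_sub_cancel_right,
      Real.rpow_add_one hz0.ne', Real.rpow_add_one hz1'.ne', Real.rpow_add_one hzr.ne', hza]
    ring

/-- generic case A > Ā > 0: the integral formula
`P(k) = C ∫₀¹ z^{k−1+B/A} (1−z)^{1/(A−Ā)} (A/Ā − z)^{B̄/Ā − 1/(A−Ā) − B/A} dz`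
satisfies the steady-state recurrence
`(1 + (A+Ā)k + B + B̄) P(k) = (A(k−1)+B) P(k−1) + (Ā(k+1)+B̄) P(k+1)` whenever
`k − 1 + B/A > 0`. -/
theorem integral_solution_generic
    (A Abar B Bbar C : ℝ) (hAA : Abar < A) (hAbar : 0 < Abar) (hB : 0 ≤ B)
    (P : ℕ → ℝ)
    (hP : ∀ k : ℕ, P k
      = C * ∫ z in (0:ℝ)..1,
          z ^ ((k : ℝ) - 1 + B / A) * (1 - z) ^ (1 / (A - Abar))
            * (A / Abar - z) ^ (Bbar / Abar - 1 / (A - Abar) - B / A)) :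
    ∀ k : ℕ, 1 ≤ k → 0 < (k : ℝ) - 1 + B / A →
      (1 + (A + Abar) * k + B + Bbar) * P k
        = (A * ((k : ℝ) - 1) + B) * P (k - 1)
          + (Abar * ((k : ℝ) + 1) + Bbar) * P (k + 1) := by
  intro k hk ha
  have hA : 0 < A := hAbar.trans hAA
  have hd : 0 < A - Abar := sub_pos.2 hAA
  have h := integral_rpow_mul_one_sub_rpow_mul_sub_rpow_contiguous
    (Bbar / Abar - 1 / (A - Abar) - B / A) ha (one_div_pos.2 hd).le ((one_lt_div hAbar).2 hAA)
  have c0 : 1 + (A + Abar) * k + B + Bbar = Abar * (((k : ℝ) - 1 + B / A) * (1 + A / Abar)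
      + (1 / (A - Abar) + 1) * (A / Abar) + (Bbar / Abar - 1 / (A - Abar) - B / A + 1)) := by
    field_simp
    ring
  have c1 : A * ((k : ℝ) - 1) + B = Abar * (((k : ℝ) - 1 + B / A) * (A / Abar)) := by
    field_simp
  have c2 : Abar * ((k : ℝ) + 1) + Bbar = Abar * ((k : ℝ) - 1 + B / A + 1 / (A - Abar)
      + (Bbar / Abar - 1 / (A - Abar) - B / A) + 2) := by
    field_simp
    ring
  have e1 : ((k - 1 : ℕ) : ℝ) - 1 + B / A = (k : ℝ) - 1 + B / A - 1 := by
    push_cast [Nat.cast_sub hk]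
    ring
  have e2 : ((k + 1 : ℕ) : ℝ) - 1 + B / A = (k : ℝ) - 1 + B / A + 1 := by
    push_cast
    ring
  rw [hP k, hP (k - 1), hP (k + 1), e1, e2, c0, c1, c2]
  linear_combination Abar * C * h
end

section
/- Let A ≥ 0, Ā ≥ 0 not both zero with A ≤ Ā, let B, B̄ be reals and m ∈ ℕ, and let P : ℕ → ℝ be nonnegative and satisfy, for all integers k > m, (1 + (A+Ā)k + B + B̄)·P(k) = (A(k−1)+B)·P(k−1) + (Ā(k+1)+B̄)·P(k+1). Then P is not power-law: there exist no constants C > 0 and γ > 1 such that lim_{k→∞} k^γ·P(k) = C. -/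
open Filter Topology

/-- If `k ^ γ * P k → C`, then `k ^ (γ - 1) * ((a * k + b) * P k) → a * C`. -/
theorem tendsto_rpow_sub_one_mul_affine_mul {P : ℕ → ℝ} {C γ : ℝ} (a b : ℝ)
    (h : Tendsto (fun k : ℕ => (k : ℝ) ^ γ * P k) atTop (𝓝 C)) :
    Tendsto (fun k : ℕ => (k : ℝ) ^ (γ - 1) * ((a * k + b) * P k)) atTop (𝓝 (a * C)) := by
  have hb : Tendsto (fun k : ℕ => a + b / (k : ℝ)) atTop (𝓝 (a + 0)) :=
    tendsto_const_nhds.add (tendsto_const_div_atTop_nhds_zero_nat b)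
  rw [add_zero] at hb
  refine (hb.mul h).congr' ?_
  filter_upwards [eventually_gt_atTop 0] with k hk
  have hk' : (0 : ℝ) < k := by exact_mod_cast hk
  rw [Real.rpow_sub_one hk'.ne']
  field_simp

/-- If `k ^ s * X k → L`, then also `k ^ s * X (k + 1) → L`. -/
theorem tendsto_rpow_mul_comp_add_one {X : ℕ → ℝ} {L s : ℝ}
    (h : Tendsto (fun k : ℕ => (k : ℝ) ^ s * X k) atTop (𝓝 L)) :
    Tendsto (fun k : ℕ => (k : ℝ) ^ s * X (k + 1)) atTop (𝓝 L) := by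
  have hq : Tendsto (fun k : ℕ => ((k : ℝ) / (k + 1)) ^ s) atTop (𝓝 1) := by
    simpa using (tendsto_natCast_div_add_atTop (1 : ℝ)).rpow_const (p := s) (Or.inl one_ne_zero)
  have hs := hq.mul (h.comp (tendsto_add_atTop_nat 1))
  rw [one_mul] at hs
  refine hs.congr fun k => ?_
  have hk : (0 : ℝ) < (k : ℝ) + 1 := by positivity
  have hk' := (Real.rpow_pos_of_pos hk s).ne'
  simp only [Function.comp_apply, Nat.cast_add, Nat.cast_one]
  rw [Real.div_rpow k.cast_nonneg hk.le]
  field_simp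

/-- A sequence whose decrements on `(k, k + n]` are at least `c` drops by at least `n * c`. -/
theorem mul_le_sub_of_le_decrement {J : ℕ → ℝ} {c : ℝ} {k : ℕ} (n : ℕ)
    (h : ∀ i < n, c ≤ J (k + i) - J (k + i + 1)) : n * c ≤ J k - J (k + n) := by
  induction n with
  | zero => simp
  | succ n ih =>
    have h1 := ih fun i hi => h i (by omega)
    have h2 := h n (by omega)
    rw [← add_assoc]
    push_cast
    linarith

/-- when `A ≤ Ā` (and `A, Ā ≥ 0` are not both zero) a nonnegative
solution of the steady-state recurrence for `k > m` is not power-law. -/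
theorem not_power_law_of_A_le_Abar
    (A Abar B Bbar : ℝ) (m : ℕ)
    (hA : 0 ≤ A) (hAbar : 0 ≤ Abar) (hAA : ¬(A = 0 ∧ Abar = 0)) (hle : A ≤ Abar)
    (P : ℕ → ℝ)
    (hP_nonneg : ∀ k, 0 ≤ P k)
    (hrec : ∀ k : ℕ, m < k →
      (1 + (A + Abar) * k + B + Bbar) * P k
        = (A * ((k : ℝ) - 1) + B) * P (k - 1)
          + (Abar * ((k : ℝ) + 1) + Bbar) * P (k + 1)) :
    ¬ ∃ C : ℝ, 0 < C ∧ ∃ γ : ℝ, 1 < γ ∧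
        Tendsto (fun k : ℕ => (k : ℝ) ^ γ * P k) atTop (𝓝 C) := by
  rintro ⟨C, hC, γ, hγ, h⟩
  -- The net flux from degree `k` to degree `k + 1`; its decrements are the values of `P`.
  let J : ℕ → ℝ := fun k => (A * k + B) * P k - (Abar * ((k + 1 : ℕ) : ℝ) + Bbar) * P (k + 1)
  have hJ : ∀ k, m ≤ k → J k - J (k + 1) = P (k + 1) := by
    intro k hk
    have := hrec (k + 1) (by omega)
    simp only [Nat.add_sub_cancel] at this
    simp only [J]
    push_cast at this ⊢
    linarith
  have hlim : Tendsto (fun k : ℕ => (k : ℝ) ^ (γ - 1) * J k) atTop (𝓝 (A * C - Abar * C)) := by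
    refine ((tendsto_rpow_sub_one_mul_affine_mul A B h).sub
      (tendsto_rpow_mul_comp_add_one (X := fun k => (Abar * k + Bbar) * P k)
        (tendsto_rpow_sub_one_mul_affine_mul Abar Bbar h))).congr fun k => ?_
    simp only [J]
    ring
  have hdouble : Tendsto (fun k : ℕ => k + k) atTop atTop :=
    tendsto_atTop_mono (fun k => Nat.le_add_left k k) tendsto_id
  have hdiff : Tendsto (fun k : ℕ => (k : ℝ) ^ (γ - 1) * (J k - J (k + k))) atTop
      (𝓝 ((A * C - Abar * C) - ((2 : ℝ) ^ (γ - 1))⁻¹ * (A * C - Abar * C))) := by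
    refine (hlim.sub ((hlim.comp hdouble).const_mul ((2 : ℝ) ^ (γ - 1))⁻¹)).congr fun k => ?_
    have h2 : (0 : ℝ) < 2 ^ (γ - 1) := by positivity
    simp only [Function.comp_apply, Nat.cast_add]
    rw [← two_mul (k : ℝ), Real.mul_rpow zero_le_two k.cast_nonneg]
    field_simp
  have hlower : ∀ᶠ k : ℕ in atTop,
      C / 2 / (2 : ℝ) ^ γ ≤ (k : ℝ) ^ (γ - 1) * (J k - J (k + k)) := by
    obtain ⟨N, hN⟩ := eventually_atTop.1 (h.eventually_const_le (half_lt_self hC))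
    filter_upwards [eventually_ge_atTop N, eventually_ge_atTop m, eventually_gt_atTop 0]
      with k hkN hkm hk
    have hk' : (0 : ℝ) < k := by exact_mod_cast hk
    have hdrop := mul_le_sub_of_le_decrement (J := J) (k := k)
      (c := C / 2 / (2 * k : ℝ) ^ γ) k fun i hi => by
        rw [hJ _ (by omega), div_le_iff₀ (by positivity), mul_comm]
        refine (hN (k + i + 1) (by omega)).trans ?_
        refine mul_le_mul_of_nonneg_right ?_ (hP_nonneg _)
        refine Real.rpow_le_rpow (Nat.cast_nonneg _) ?_ (by linarith)
        exact_mod_cast (by omega : k + i + 1 ≤ 2 * k)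
    refine le_trans (le_of_eq ?_) (mul_le_mul_of_nonneg_left hdrop (by positivity))
    rw [Real.mul_rpow zero_le_two hk'.le, Real.rpow_sub_one hk'.ne']
    field_simp
  have hge := ge_of_tendsto hdiff hlower
  have hpos : 0 < C / 2 / (2 : ℝ) ^ γ := by positivity
  have hinv : ((2 : ℝ) ^ (γ - 1))⁻¹ ≤ 1 :=
    inv_le_one_of_one_le₀ (Real.one_le_rpow one_le_two (by linarith))
  nlinarith [mul_le_mul_of_nonneg_right hle hC.le]
end

section
/- Let A > 0, B ≥ 0, B̄ ≥ 0 be reals. Then lim_{k→∞} k^{1+1/A} · ∫₀¹ z^{k−1+B/A}·(1−z)^{1/A}·e^{−(B̄/A)·z} dz = Γ(1 + 1/A) · e^{−B̄/A}. Consequently, for any C ≠ 0, the sequence P(k) = C·∫₀¹ z^{k−1+B/A}(1−z)^{1/A}e^{−(B̄/A)z} dz satisfies P(k) ∼ C·Γ(1+1/A)·e^{−B̄/A}·k^{−(1+1/A)} as k → ∞. -/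
open Filter Topology intervalIntegral Real

open MeasureTheory Set in
/-- Laplace asymptotics of the Beta-type integral with an exponential factor, as the first
exponent tends to infinity. -/
theorem tendsto_rpow_mul_integral_beta_exp {a b c : ℝ} (ha : 0 < a) (hb : 0 ≤ b) (hc : 0 ≤ c) :
    Tendsto (fun k : ℕ => (k : ℝ) ^ (1 + a) *
        ∫ z in (0:ℝ)..1, z ^ ((k : ℝ) - 1 + b) * (1 - z) ^ a * Real.exp (-c * z))
      atTop (𝓝 (Real.Gamma (1 + a) * Real.exp (-c))) := by
  let F : ℕ → ℝ → ℝ := fun k t =>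
    (1 - t / k) ^ ((k : ℝ) - 1 + b) * t ^ a * Real.exp (-c * (1 - t / k))
  have hlim : Tendsto (fun k : ℕ => ∫ t in Ioi (0:ℝ), (Ioc (0:ℝ) k).indicator (F k) t) atTop
      (𝓝 (∫ t in Ioi (0:ℝ), Real.exp (-t) * t ^ (1 + a - 1) * Real.exp (-c))) := by
    refine tendsto_integral_filter_of_dominated_convergence
      (fun t => t ^ a * Real.exp (-(1 / 2) * t ^ (1:ℝ))) ?_ ?_ ?_ ?_
    · refine Eventually.of_forall fun k => Measurable.aestronglyMeasurable ?_
      refine Measurable.indicator ?_ measurableSet_Ioc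
      fun_prop
    · filter_upwards [eventually_ge_atTop 2] with k hk
      refine (ae_restrict_mem measurableSet_Ioi).mono fun t ht => ?_
      have ht0 : 0 < t := ht
      have hk2 : (2:ℝ) ≤ k := by exact_mod_cast hk
      have hk0 : (0:ℝ) < k := by linarith
      by_cases htk : t ∈ Ioc (0:ℝ) k
      · have h1 : 0 ≤ 1 - t / k := by
          have := (div_le_one hk0).2 htk.2
          linarith
        have htd : 0 < t / k := by positivity
        have hF0 : 0 ≤ F k t := by positivity
        rw [indicator_of_mem htk, Real.norm_of_nonneg hF0]
        have h2 : (1 - t / k) ^ ((k : ℝ) - 1 + b) ≤ Real.exp (-(1 / 2) * t ^ (1:ℝ)) := by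
          calc (1 - t / k) ^ ((k : ℝ) - 1 + b)
              ≤ (Real.exp (-(t / k))) ^ ((k : ℝ) - 1 + b) :=
                Real.rpow_le_rpow h1 (Real.one_sub_le_exp_neg _) (by linarith)
            _ = Real.exp (-(t / k) * ((k : ℝ) - 1 + b)) := (Real.exp_mul _ _).symm
            _ ≤ Real.exp (-(1 / 2) * t ^ (1:ℝ)) := by
                rw [Real.exp_le_exp, Real.rpow_one]
                have h3 : t = t / k * k := by field_simp
                nlinarith [mul_nonneg htd.le hb, mul_nonneg htd.le (sub_nonneg.2 hk2)]
        have h3 : Real.exp (-c * (1 - t / k)) ≤ 1 := by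
          rw [Real.exp_le_one_iff]
          nlinarith [mul_nonneg hc h1]
        calc F k t ≤ Real.exp (-(1 / 2) * t ^ (1:ℝ)) * t ^ a * 1 := by
              dsimp only [F]
              gcongr
          _ = t ^ a * Real.exp (-(1 / 2) * t ^ (1:ℝ)) := by ring
      · rw [indicator_of_notMem htk, norm_zero]
        positivity
    · exact integrableOn_rpow_mul_exp_neg_mul_rpow (by linarith) one_pos (by norm_num)
    · refine (ae_restrict_mem measurableSet_Ioi).mono fun t ht => ?_
      have ht0 : 0 < t := ht
      have hd : Tendsto (fun k : ℕ => 1 - t / (k : ℝ)) atTop (𝓝 1) := by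
        simpa using (tendsto_const_div_atTop_nhds_zero_nat t).const_sub 1
      have h1 : Tendsto (fun k : ℕ => (1 + -t / (k : ℝ)) ^ k) atTop (𝓝 (Real.exp (-t))) :=
        Real.tendsto_one_add_div_pow_exp (-t)
      have h2 : Tendsto (fun k : ℕ => (1 - t / (k : ℝ)) ^ (b - 1)) atTop (𝓝 1) := by
        simpa using hd.rpow_const (p := b - 1) (Or.inl one_ne_zero)
      have h3 : Tendsto (fun k : ℕ => Real.exp (-c * (1 - t / (k : ℝ)))) atTop
          (𝓝 (Real.exp (-c))) := by
        simpa using (hd.const_mul (-c)).rexp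
      have h4 := ((h1.mul h2).mul_const (t ^ a)).mul h3
      rw [mul_one] at h4
      rw [add_sub_cancel_left]
      refine h4.congr' ?_
      filter_upwards [eventually_gt_atTop ⌈t⌉₊] with k hk
      have htk : t < k := Nat.lt_of_ceil_lt hk
      have hk0 : (0:ℝ) < k := ht0.trans htk
      have hp : 0 < 1 - t / k := by
        have := (div_lt_one hk0).2 htk
        linarith
      rw [indicator_of_mem (show t ∈ Ioc (0:ℝ) k from ⟨ht0, htk.le⟩)]
      dsimp only [F]
      rw [show (k : ℝ) - 1 + b = k + (b - 1) by ring, Real.rpow_add hp, Real.rpow_natCast,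
        neg_div, ← sub_eq_add_neg]
  rw [MeasureTheory.integral_mul_const, ← Real.Gamma_eq_integral (by linarith)] at hlim
  refine hlim.congr' ?_
  filter_upwards [eventually_gt_atTop 0] with k hk
  have hk0 : (0:ℝ) < k := by exact_mod_cast hk
  have hsub := intervalIntegral.integral_comp_sub_div (a := 0) (b := (k : ℝ))
    (fun z : ℝ => z ^ ((k : ℝ) - 1 + b) * (1 - z) ^ a * Real.exp (-c * z)) hk0.ne' 1
  rw [div_self hk0.ne', sub_self, zero_div, sub_zero, smul_eq_mul] at hsub
  rw [setIntegral_indicator measurableSet_Ioc, inter_eq_right.2 Ioc_subset_Ioi_self,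
    Real.rpow_add hk0, Real.rpow_one, mul_right_comm, ← hsub, mul_comm,
    ← intervalIntegral.integral_const_mul, intervalIntegral.integral_of_le hk0.le]
  refine setIntegral_congr_fun measurableSet_Ioc fun t ht => ?_
  dsimp only [F]
  rw [sub_sub_cancel, Real.div_rpow ht.1.le hk0.le]
  have : (k : ℝ) ^ a ≠ 0 := (Real.rpow_pos_of_pos hk0 a).ne'
  field_simp

/-- case A > Ā = 0: tail asymptotics
`k^{1+1/A} ∫₀¹ z^{k−1+B/A} (1−z)^{1/A} e^{−(B̄/A)z} dz → Γ(1+1/A) e^{−B̄/A}`,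
and consequently `P(k) ∼ C Γ(1+1/A) e^{−B̄/A} k^{−(1+1/A)}`. -/
theorem tail_asymptotics_Abar_zero
    (A B Bbar : ℝ) (hA : 0 < A) (hB : 0 ≤ B) (hBbar : 0 ≤ Bbar) :
    Tendsto (fun k : ℕ => (k : ℝ) ^ (1 + 1 / A) *
        ∫ z in (0:ℝ)..1,
          z ^ ((k : ℝ) - 1 + B / A) * (1 - z) ^ (1 / A)
            * Real.exp (-(Bbar / A) * z))
      atTop (𝓝 (Real.Gamma (1 + 1 / A) * Real.exp (-Bbar / A))) ∧
    ∀ C : ℝ, C ≠ 0 →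
      Tendsto (fun k : ℕ =>
          (C * ∫ z in (0:ℝ)..1,
              z ^ ((k : ℝ) - 1 + B / A) * (1 - z) ^ (1 / A)
                * Real.exp (-(Bbar / A) * z))
            / (C * Real.Gamma (1 + 1 / A) * Real.exp (-Bbar / A)
                * (k : ℝ) ^ (-(1 + 1 / A))))
        atTop (𝓝 1) := by
  have hmain := tendsto_rpow_mul_integral_beta_exp (a := 1 / A) (b := B / A) (c := Bbar / A)
    (by positivity) (by positivity) (by positivity)
  simp only [← neg_div] at hmain ⊢
  refine ⟨hmain, fun C hC => ?_⟩
  have hG : Real.Gamma (1 + 1 / A) * Real.exp (-Bbar / A) ≠ 0 :=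
    mul_ne_zero (Real.Gamma_pos_of_pos (by positivity)).ne' (Real.exp_ne_zero _)
  have h := hmain.div_const (Real.Gamma (1 + 1 / A) * Real.exp (-Bbar / A))
  rw [div_self hG] at h
  refine h.congr' ?_
  filter_upwards [eventually_gt_atTop 0] with k hk
  have hk0 : (0:ℝ) < k := by exact_mod_cast hk
  rw [Real.rpow_neg hk0.le, mul_assoc C, mul_assoc C, mul_div_mul_left _ _ hC,
    ← div_div _ _ (_)⁻¹, div_inv_eq_mul, div_mul_eq_mul_div, mul_comm]
end

section
/- Let A > Ā > 0, B ≥ 0, B̄ ≥ 0 be reals and set δ = B̄/Ā − 1/(A−Ā) − B/A. Then lim_{k→∞} k^{1+1/(A−Ā)} · ∫₀¹ z^{k−1+B/A}·(1−z)^{1/(A−Ā)}·(A/Ā − z)^{δ} dz = Γ(1 + 1/(A−Ā)) · (A/Ā − 1)^{δ}. Consequently, for any C ≠ 0, the sequence P(k) = C·∫₀¹ z^{k−1+B/A}(1−z)^{1/(A−Ā)}(A/Ā − z)^{δ} dz satisfies P(k) ∼ C·Γ(1+1/(A−Ā))·(A/Ā − 1)^{δ}·k^{−(1+1/(A−Ā))}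 as k → ∞. -/
open Filter Topology intervalIntegral Real

/-- Watson's lemma at the right endpoint, in Mellin form: as `k → ∞`, the weight
`z ^ (k - 1 + b) * (1 - z) ^ α` concentrates at `z = 1` with total mass `Γ(1 + α) k ^ (-(1 + α))`. -/
theorem tendsto_rpow_mul_integral_rpow_mul_one_sub_rpow {α b M : ℝ} (hα : -1 < α) (hb : 0 ≤ b)
    {g : ℝ → ℝ} (hg : Measurable g) (hM : ∀ z ∈ Set.Icc (0 : ℝ) 1, |g z| ≤ M)
    (hg1 : ContinuousAt g 1) :
    Tendsto (fun k : ℕ => (k : ℝ) ^ (1 + α) *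
        ∫ z in (0 : ℝ)..1, z ^ ((k : ℝ) - 1 + b) * (1 - z) ^ α * g z)
      atTop (𝓝 (Real.Gamma (1 + α) * g 1)) := by
  have hlim : Tendsto (fun k : ℕ => ∫ t in Set.Ioi (0 : ℝ), (Set.Ioc (0 : ℝ) k).indicator
        (fun t => (1 - t / k) ^ ((k : ℝ) - 1 + b) * t ^ α * g (1 - t / k)) t)
      atTop (𝓝 (∫ t in Set.Ioi (0 : ℝ), Real.exp (-t) * t ^ α * g 1)) := by
    refine MeasureTheory.tendsto_integral_filter_of_dominated_convergence
      (fun t => t ^ α * Real.exp (-(1 / 2) * t) * M) ?_ ?_ ?_ ?_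
    · refine Eventually.of_forall fun k => Measurable.aestronglyMeasurable ?_
      exact Measurable.indicator (by fun_prop) measurableSet_Ioc
    · filter_upwards [eventually_ge_atTop 2] with k hk
      have hk2 : (2 : ℝ) ≤ k := by exact_mod_cast hk
      have hk0 : (0 : ℝ) < k := by linarith
      filter_upwards [MeasureTheory.ae_restrict_mem measurableSet_Ioi] with t ht
      have ht0 : (0 : ℝ) < t := ht
      have hM0 : 0 ≤ M := (abs_nonneg _).trans (hM 1 (by simp))
      by_cases htk : t ∈ Set.Ioc (0 : ℝ) k
      · rw [Set.indicator_of_mem htk]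
        have h1 : t / k ≤ 1 := (div_le_one hk0).2 htk.2
        have h0 : 0 < t / k := by positivity
        have hexp : (1 - t / k) ^ ((k : ℝ) - 1 + b) ≤ Real.exp (-(1 / 2) * t) := by
          calc (1 - t / k) ^ ((k : ℝ) - 1 + b)
              ≤ (Real.exp (-(t / k))) ^ ((k : ℝ) - 1 + b) :=
                Real.rpow_le_rpow (by linarith) (Real.one_sub_le_exp_neg _) (by linarith)
            _ = Real.exp (-(t / k) * ((k : ℝ) - 1 + b)) := (Real.exp_mul _ _).symm
            _ ≤ Real.exp (-(1 / 2) * t) := by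
                refine Real.exp_le_exp.2 ?_
                have h2 : t / k * (k / 2) = 1 / 2 * t := by field_simp
                nlinarith
        have hz : 0 ≤ 1 - t / k := by linarith
        rw [Real.norm_eq_abs, abs_mul, abs_of_nonneg (by positivity)]
        calc (1 - t / k) ^ ((k : ℝ) - 1 + b) * t ^ α * |g (1 - t / k)|
            ≤ Real.exp (-(1 / 2) * t) * t ^ α * M := by
              gcongr
              exact hM _ ⟨hz, by linarith⟩
          _ = t ^ α * Real.exp (-(1 / 2) * t) * M := by ring
      · rw [Set.indicator_of_notMem htk, norm_zero]
        positivity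
    · have h := integrableOn_rpow_mul_exp_neg_mul_rpow (p := 1) (b := 1 / 2) hα one_pos
        (by norm_num)
      simp only [Real.rpow_one] at h
      exact h.mul_const M
    · filter_upwards [MeasureTheory.ae_restrict_mem measurableSet_Ioi] with t ht
      have ht0 : (0 : ℝ) < t := ht
      have hz : Tendsto (fun k : ℕ => 1 - t / (k : ℝ)) atTop (𝓝 1) := by
        simpa using (tendsto_const_div_atTop_nhds_zero_nat t).const_sub 1
      have hpow : Tendsto (fun k : ℕ => (1 - t / (k : ℝ)) ^ k) atTop (𝓝 (Real.exp (-t))) := by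
        simpa [neg_div, ← sub_eq_add_neg] using Real.tendsto_one_add_div_pow_exp (-t)
      have hrpow : Tendsto (fun k : ℕ => (1 - t / (k : ℝ)) ^ (b - 1)) atTop (𝓝 1) := by
        simpa using hz.rpow_const (p := b - 1) (Or.inl one_ne_zero)
      have hprod := ((hpow.mul hrpow).mul_const (t ^ α)).mul (hg1.tendsto.comp hz)
      rw [mul_one] at hprod
      refine hprod.congr' ?_
      filter_upwards [eventually_gt_atTop ⌈t⌉₊] with k hk
      have hk' : t < k := Nat.lt_of_ceil_lt hk
      have hpos : 0 < 1 - t / (k : ℝ) := sub_pos.2 ((div_lt_one (ht0.trans hk')).2 hk')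
      rw [Set.indicator_of_mem (show t ∈ Set.Ioc (0 : ℝ) k from ⟨ht0, hk'.le⟩),
        ← Real.rpow_natCast, ← Real.rpow_add hpos, Function.comp_apply,
        show (k : ℝ) + (b - 1) = k - 1 + b by ring]
  have hval : ∫ t in Set.Ioi (0 : ℝ), Real.exp (-t) * t ^ α * g 1
      = Real.Gamma (1 + α) * g 1 := by
    rw [MeasureTheory.integral_mul_const, Real.Gamma_eq_integral (by linarith),
      add_sub_cancel_left]
  rw [hval] at hlim
  refine hlim.congr' ?_
  filter_upwards [eventually_gt_atTop 0] with k hk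
  have hk0 : (0 : ℝ) < k := by exact_mod_cast hk
  have hsub := intervalIntegral.integral_comp_sub_div (a := 0) (b := k)
    (fun z : ℝ => z ^ ((k : ℝ) - 1 + b) * (1 - z) ^ α * g z) hk0.ne' 1
  rw [div_self hk0.ne', sub_self, zero_div, sub_zero, smul_eq_mul] at hsub
  rw [Real.rpow_add hk0, Real.rpow_one, mul_comm (k : ℝ), mul_assoc, ← hsub,
    MeasureTheory.setIntegral_indicator measurableSet_Ioc,
    Set.inter_eq_right.2 Set.Ioc_subset_Ioi_self, ← intervalIntegral.integral_of_le hk0.le,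
    ← intervalIntegral.integral_const_mul]
  refine intervalIntegral.integral_congr fun t ht => ?_
  rw [Set.uIcc_of_le hk0.le] at ht
  have hpos : (0 : ℝ) < (k : ℝ) ^ α := Real.rpow_pos_of_pos hk0 α
  simp only [sub_sub_cancel]
  rw [Real.div_rpow ht.1 hk0.le]
  field_simp

/-- case A > Ā > 0: with `δ = B̄/Ā − 1/(A−Ā) − B/A`, tail asymptotics
`k^{1+1/(A−Ā)} ∫₀¹ z^{k−1+B/A} (1−z)^{1/(A−Ā)} (A/Ā − z)^δ dz → Γ(1+1/(A−Ā)) (A/Ā − 1)^δ`,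
and consequently `P(k) ∼ C Γ(1+1/(A−Ā)) (A/Ā − 1)^δ k^{−(1+1/(A−Ā))}`. -/
theorem tail_asymptotics_generic
    (A Abar B Bbar : ℝ) (hAA : Abar < A) (hAbar : 0 < Abar)
    (hB : 0 ≤ B) (hBbar : 0 ≤ Bbar)
    (δ : ℝ) (hδ : δ = Bbar / Abar - 1 / (A - Abar) - B / A) :
    Tendsto (fun k : ℕ => (k : ℝ) ^ (1 + 1 / (A - Abar)) *
        ∫ z in (0:ℝ)..1,
          z ^ ((k : ℝ) - 1 + B / A) * (1 - z) ^ (1 / (A - Abar))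
            * (A / Abar - z) ^ δ)
      atTop (𝓝 (Real.Gamma (1 + 1 / (A - Abar)) * (A / Abar - 1) ^ δ)) ∧
    ∀ C : ℝ, C ≠ 0 →
      Tendsto (fun k : ℕ =>
          (C * ∫ z in (0:ℝ)..1,
              z ^ ((k : ℝ) - 1 + B / A) * (1 - z) ^ (1 / (A - Abar))
                * (A / Abar - z) ^ δ)
            / (C * Real.Gamma (1 + 1 / (A - Abar)) * (A / Abar - 1) ^ δ
                * (k : ℝ) ^ (-(1 + 1 / (A - Abar)))))
        atTop (𝓝 1) := by
  have hα : 0 < 1 / (A - Abar) := one_div_pos.2 (sub_pos.2 hAA)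
  have hratio : 1 < A / Abar := (one_lt_div hAbar).2 hAA
  have hcont : ∀ z ≤ (1 : ℝ), ContinuousAt (fun z : ℝ => (A / Abar - z) ^ δ) z := fun z hz =>
    (continuousAt_const.sub continuousAt_id).rpow_const
      (Or.inl (sub_pos.2 (hz.trans_lt hratio)).ne')
  obtain ⟨M, hM⟩ := isCompact_Icc.exists_bound_of_continuousOn
    (s := Set.Icc (0 : ℝ) 1) fun z hz => (hcont z hz.2).continuousWithinAt
  have hmain := tendsto_rpow_mul_integral_rpow_mul_one_sub_rpow (α := 1 / (A - Abar))
    (by linarith) (div_nonneg hB (hAbar.trans hAA).le) (by fun_prop) hM (hcont 1 le_rfl)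
  refine ⟨hmain, fun C hC => ?_⟩
  have hΓ : 0 < Real.Gamma (1 + 1 / (A - Abar)) := Real.Gamma_pos_of_pos (by linarith)
  have hδpos : 0 < (A / Abar - 1) ^ δ := Real.rpow_pos_of_pos (by linarith) δ
  have hquot := hmain.div_const (Real.Gamma (1 + 1 / (A - Abar)) * (A / Abar - 1) ^ δ)
  rw [div_self (mul_pos hΓ hδpos).ne'] at hquot
  refine hquot.congr' ?_
  filter_upwards [eventually_gt_atTop 0] with k hk
  have hk0 : (0 : ℝ) < k := by exact_mod_cast hk
  rw [Real.rpow_neg hk0.le]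
  rw [mul_assoc C, mul_assoc C, mul_div_mul_left _ _ hC,
    div_mul_eq_div_div _ _ (_⁻¹), div_inv_eq_mul, div_mul_eq_mul_div,
    mul_comm ((k : ℝ) ^ _)]
end

section
/- lim_{k→∞} k⁵ · (171/4) · ∫₀¹ z^{k−1}·(1−z)⁴·(3/2 − z)^{−4} dz = 16416. In particular, the sequence P(k) = (171/4)·∫₀¹ z^{k−1}(1−z)⁴(3/2−z)^{−4} dz satisfies P(k) ∼ 16416·k^{−5} as k → ∞, so it is power-law with scaling exponent 5. -/
open Filter Topology intervalIntegral

theorem integral_pow_mul_one_sub_pow (n m : ℕ) :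
    ∫ z in (0:ℝ)..1, z ^ n * (1 - z) ^ m
      = (n.factorial * m.factorial : ℝ) / (n + m + 1).factorial := by
  induction m generalizing n with
  | zero =>
    simp only [pow_zero, mul_one, integral_pow, Nat.factorial_zero, add_zero,
      Nat.factorial_succ]
    push_cast
    have := n.factorial_pos
    field_simp
    simp
  | succ m ih =>
    have hsplit : ∀ z : ℝ,
        z ^ n * (1 - z) ^ (m + 1) = z ^ n * (1 - z) ^ m - z ^ (n + 1) * (1 - z) ^ m := by
      intro z; ring
    simp_rw [hsplit]
    rw [integral_sub (Continuous.intervalIntegrable (by fun_prop) _ _)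
      (Continuous.intervalIntegrable (by fun_prop) _ _), ih n, ih (n + 1),
      show n + 1 + m + 1 = (n + m + 1) + 1 by ring,
      show n + (m + 1) + 1 = (n + m + 1) + 1 by ring,
      Nat.factorial_succ (n + m + 1), Nat.factorial_succ n, Nat.factorial_succ m]
    have := (n + m + 1).factorial_pos
    push_cast
    field_simp
    ring

theorem tendsto_pow_mul_integral_pow_mul_one_sub_pow (m : ℕ) :
    Tendsto (fun k : ℕ => (k : ℝ) ^ (m + 1) * ∫ z in (0:ℝ)..1, z ^ (k - 1) * (1 - z) ^ m)
      atTop (𝓝 m.factorial) := by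
  induction m with
  | zero =>
    refine tendsto_const_nhds.congr' ?_
    filter_upwards [eventually_ge_atTop 1] with k hk
    obtain ⟨n, rfl⟩ := Nat.exists_eq_add_of_le' hk
    simp only [pow_zero, mul_one, integral_pow, Nat.add_sub_cancel, Nat.factorial_zero]
    push_cast
    field_simp
    simp
  | succ m ih =>
    have hratio : Tendsto (fun k : ℕ => (k : ℝ) / (k + (m + 1 : ℝ))) atTop (𝓝 1) :=
      tendsto_natCast_div_add_atTop _
    have hlim := (hratio.const_mul (m + 1 : ℝ)).mul ih
    rw [mul_one, ← Nat.cast_succ, ← Nat.cast_mul, ← Nat.factorial_succ] at hlim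
    refine hlim.congr' ?_
    filter_upwards [eventually_ge_atTop 1] with k hk
    obtain ⟨n, rfl⟩ := Nat.exists_eq_add_of_le' hk
    rw [Nat.add_sub_cancel, integral_pow_mul_one_sub_pow, integral_pow_mul_one_sub_pow,
      show n + (m + 1) + 1 = (n + m + 1) + 1 by ring,
      Nat.factorial_succ (n + m + 1), Nat.factorial_succ m]
    have := (n + m + 1).factorial_pos
    push_cast
    field_simp
    ring

theorem one_div_three_halves_sub_pow_four_bounds {z : ℝ} (hz : z ≤ 1) :
    16 - 128 * (1 - z) ≤ 1 / (3 / 2 - z) ^ 4 ∧ 1 / (3 / 2 - z) ^ 4 ≤ 16 := by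
  obtain ⟨t, ht, rfl⟩ : ∃ t : ℝ, 0 ≤ t ∧ z = 1 - t := ⟨1 - z, by linarith, by ring⟩
  have hpos : 0 < (3 / 2 - (1 - t)) ^ 4 := pow_pos (by linarith) 4
  constructor
  · rw [le_div_iff₀ hpos]
    have : 0 ≤ 40 * t ^ 2 + 160 * t ^ 3 + 240 * t ^ 4 + 128 * t ^ 5 := by positivity
    linarith
  · rw [div_le_iff₀ hpos]
    have : 0 ≤ 8 * t + 24 * t ^ 2 + 32 * t ^ 3 + 16 * t ^ 4 := by positivity
    linarith

theorem integral_tail_bounds (n : ℕ) :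
    16 * (∫ z in (0:ℝ)..1, z ^ n * (1 - z) ^ 4) - 128 * (∫ z in (0:ℝ)..1, z ^ n * (1 - z) ^ 5)
        ≤ ∫ z in (0:ℝ)..1, z ^ n * (1 - z) ^ 4 / (3 / 2 - z) ^ 4 ∧
      ∫ z in (0:ℝ)..1, z ^ n * (1 - z) ^ 4 / (3 / 2 - z) ^ 4
        ≤ 16 * ∫ z in (0:ℝ)..1, z ^ n * (1 - z) ^ 4 := by
  have hint : IntervalIntegrable (fun z : ℝ => z ^ n * (1 - z) ^ 4 / (3 / 2 - z) ^ 4)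
      MeasureTheory.volume 0 1 := by
    refine ContinuousOn.intervalIntegrable_of_Icc zero_le_one ?_
    refine ContinuousOn.div (by fun_prop) (by fun_prop) fun z hz => ?_
    exact pow_ne_zero 4 (by linarith [hz.2])
  have hnonneg : ∀ z ∈ Set.Icc (0:ℝ) 1, 0 ≤ z ^ n * (1 - z) ^ 4 := fun z hz =>
    mul_nonneg (pow_nonneg hz.1 n) (pow_nonneg (by linarith [hz.2]) 4)
  constructor
  · rw [← integral_const_mul, ← integral_const_mul,
      ← integral_sub (Continuous.intervalIntegrable (by fun_prop) _ _)
        (Continuous.intervalIntegrable (by fun_prop) _ _)]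
    refine integral_mono_on zero_le_one (Continuous.intervalIntegrable (by fun_prop) _ _) hint
      fun z hz => ?_
    have := mul_le_mul_of_nonneg_left (one_div_three_halves_sub_pow_four_bounds hz.2).1
      (hnonneg z hz)
    rw [mul_one_div] at this
    refine le_trans (le_of_eq ?_) this
    ring
  · rw [← integral_const_mul]
    refine integral_mono_on zero_le_one hint (Continuous.intervalIntegrable (by fun_prop) _ _)
      fun z hz => ?_
    have := mul_le_mul_of_nonneg_left (one_div_three_halves_sub_pow_four_bounds hz.2).2
      (hnonneg z hz)
    rw [mul_one_div] at this
    linarith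

theorem tendsto_pow_mul_integral_tail :
    Tendsto (fun k : ℕ => (k : ℝ) ^ 5 *
        ∫ z in (0:ℝ)..1, z ^ (k - 1) * (1 - z) ^ 4 / (3 / 2 - z) ^ 4)
      atTop (𝓝 384) := by
  have h4 := (tendsto_pow_mul_integral_pow_mul_one_sub_pow 4).const_mul 16
  have h5 := ((tendsto_pow_mul_integral_pow_mul_one_sub_pow 5).mul
    (tendsto_inv_atTop_nhds_zero_nat (𝕜 := ℝ))).const_mul 128
  have hlow := h4.sub h5
  norm_num [Nat.factorial] at h4 hlow
  refine tendsto_of_tendsto_of_tendsto_of_le_of_le' hlow h4 ?_ ?_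
  · filter_upwards [eventually_ge_atTop 1] with k hk
    have hk0 : (k : ℝ) ≠ 0 := by positivity
    refine le_trans (le_of_eq ?_) (mul_le_mul_of_nonneg_left (integral_tail_bounds (k - 1)).1
      (by positivity : (0:ℝ) ≤ (k : ℝ) ^ 5))
    field_simp
  · filter_upwards with k
    have := mul_le_mul_of_nonneg_left (integral_tail_bounds (k - 1)).2
      (by positivity : (0:ℝ) ≤ (k : ℝ) ^ 5)
    linarith

/-- `k⁵ · (171/4) · ∫₀¹ z^{k−1} (1−z)⁴ (3/2 − z)⁻⁴ dz → 16416`, hence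
`P(k) = (171/4) ∫₀¹ z^{k−1} (1−z)⁴ (3/2−z)⁻⁴ dz` satisfies `P(k) ∼ 16416 k⁻⁵`. -/
theorem example1_tail_asymptotics :
    Tendsto (fun k : ℕ => (k : ℝ) ^ 5 * (171 / 4) *
        ∫ z in (0:ℝ)..1, z ^ (k - 1) * (1 - z) ^ 4 / (3 / 2 - z) ^ 4)
      atTop (𝓝 16416) ∧
    Tendsto (fun k : ℕ =>
        ((171 / 4) * ∫ z in (0:ℝ)..1, z ^ (k - 1) * (1 - z) ^ 4 / (3 / 2 - z) ^ 4)
          / (16416 * (k : ℝ) ^ (-(5 : ℝ))))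
      atTop (𝓝 1) := by
  constructor
  · convert tendsto_pow_mul_integral_tail.const_mul (171 / 4) using 2
    · ring
    · norm_num
  · convert tendsto_pow_mul_integral_tail.const_mul (1 / 384) using 2 with k
    · rw [Real.rpow_neg k.cast_nonneg, show (5 : ℝ) = (5 : ℕ) by norm_num, Real.rpow_natCast,
        ← div_div, div_inv_eq_mul]
      ring
    · norm_num
end

section
/- Let P : ℕ → ℝ be nonnegative with Σ_{k=0}^∞ P(k) = 1, satisfying (1)·P(0) = (1/2)·P(1), (9/4)·P(1) = P(2), (7/2)·P(2) = (3/4)·P(1) + (3/2)·P(3) (the steady-state recursion with A = 3/4, Ā = 1/2, B = B̄ = 0, d_3 = 1, d_k = 0 otherwise), the recursion (1 + (5/4)k)·P(k) = (3/4)(k−1)·P(k−1) + (1/2)(k+1)·P(k+1) + d_k for all k ≥ 3, and such that P(k) = C·∫₀¹ z^{k−1}(1−z)⁴(3/2−z)^{−4} dz for all k ≥ 3 for some constant C. Then P(0) = 47 − (171/4)·ln 3 and C = 171/4; hence P(1) = 94 − (171/2)·ln 3, P(2) = 423/2 − (1539/8)·ln 3, and P(3) = (19/2)·(47 − (171/4)·ln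 3). -/
open intervalIntegral

/-- Integral over `[1/2, 3/2]` of a polynomial of degree at most seven divided by the fourth power
of the variable. -/
theorem integral_poly_div_pow_four (a b c d p q r s : ℝ) :
    ∫ w in (1 / 2 : ℝ)..(3 / 2),
        (a + b * w + c * w ^ 2 + d * w ^ 3 + p * w ^ 4 + q * w ^ 5 + r * w ^ 6 + s * w ^ 7) / w ^ 4
      = 208 / 81 * a + 16 / 9 * b + 4 / 3 * c + d * Real.log 3 + p + q + 13 / 12 * r + 5 / 4 * s := by
  have hpos : ∀ w ∈ Set.uIcc (1 / 2 : ℝ) (3 / 2), 0 < w := fun w hw => by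
    rw [Set.uIcc_of_le (by norm_num)] at hw
    linarith [hw.1]
  have hlog : Real.log (3 / 2) - Real.log (1 / 2) = Real.log 3 := by
    rw [← Real.log_div (by norm_num) (by norm_num)]
    norm_num
  rw [integral_eq_sub_of_hasDerivAt
    (f := fun w => -(a / 3) * (w ^ 3)⁻¹ + -(b / 2) * (w ^ 2)⁻¹ + -c * w⁻¹ + d * Real.log w
      + p * w + q / 2 * w ^ 2 + r / 3 * w ^ 3 + s / 4 * w ^ 4)]
  · linear_combination d * hlog
  · intro w hw
    have hw0 : w ≠ 0 := (hpos w hw).ne'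
    have key := ((((((((((hasDerivAt_pow 3 w).inv (pow_ne_zero 3 hw0)).const_mul (-(a / 3))).add
      (((hasDerivAt_pow 2 w).inv (pow_ne_zero 2 hw0)).const_mul (-(b / 2)))).add
      ((hasDerivAt_inv hw0).const_mul (-c))).add
      ((Real.hasDerivAt_log hw0).const_mul d)).add
      ((hasDerivAt_id w).const_mul p)).add
      ((hasDerivAt_pow 2 w).const_mul (q / 2))).add
      ((hasDerivAt_pow 3 w).const_mul (r / 3))).add
      ((hasDerivAt_pow 4 w).const_mul (s / 4)))
    refine HasDerivAt.congr_deriv key ?_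
    norm_num
    field_simp
  · refine ContinuousOn.intervalIntegrable (ContinuousOn.div (by fun_prop) (by fun_prop) ?_)
    exact fun w hw => pow_ne_zero 4 (hpos w hw).ne'

theorem integral_sq_mul_one_sub_pow_four_div :
    ∫ z in (0 : ℝ)..1, z ^ 2 * (1 - z) ^ 4 / (3 / 2 - z) ^ 4 = 94 / 9 - 19 / 2 * Real.log 3 := by
  have hsub := integral_comp_sub_left (a := 0) (b := 1)
    (fun w : ℝ => (3 / 2 - w) ^ 2 * (w - 1 / 2) ^ 4 / w ^ 4) (3 / 2)
  have hpoly := integral_poly_div_pow_four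
    (9 / 64) (-21 / 16) (79 / 16) (-19 / 2) (39 / 4) (-5) 1 0
  calc _ = ∫ z in (0 : ℝ)..1,
        (3 / 2 - (3 / 2 - z)) ^ 2 * ((3 / 2 - z) - 1 / 2) ^ 4 / (3 / 2 - z) ^ 4 := by
        congr 1; ext z; congr 1; ring
    _ = _ := hsub
    _ = _ := by
        norm_num only at hpoly ⊢
        refine Eq.trans ?_ (hpoly.trans ?_)
        · congr 1; ext w; congr 1; ring
        · ring

theorem integral_cube_mul_one_sub_pow_four_div :
    ∫ z in (0 : ℝ)..1, z ^ 3 * (1 - z) ^ 4 / (3 / 2 - z) ^ 4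
      = 253 / 12 - 307 / 16 * Real.log 3 := by
  have hsub := integral_comp_sub_left (a := 0) (b := 1)
    (fun w : ℝ => (3 / 2 - w) ^ 3 * (w - 1 / 2) ^ 4 / w ^ 4) (3 / 2)
  have hpoly := integral_poly_div_pow_four
    (27 / 128) (-135 / 64) (279 / 32) (-307 / 16) (193 / 8) (-69 / 4) (13 / 2) (-1)
  calc _ = ∫ z in (0 : ℝ)..1,
        (3 / 2 - (3 / 2 - z)) ^ 3 * ((3 / 2 - z) - 1 / 2) ^ 4 / (3 / 2 - z) ^ 4 := by
        congr 1; ext z; congr 1; ring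
    _ = _ := hsub
    _ = _ := by
        norm_num only at hpoly ⊢
        refine Eq.trans ?_ (hpoly.trans ?_)
        · congr 1; ext w; congr 1; ring
        · ring

/-- the explicit steady degree distribution of Example 1 with `m = 3`
(`A = 3/4`, `Ā = 1/2`, `B = B̄ = 0`, `d_3 = 1`): `P(0) = 47 − (171/4) ln 3`,
`C = 171/4`, and hence the stated values of `P(1)`, `P(2)`, `P(3)`. -/
theorem example1_explicit_distribution
    (P : ℕ → ℝ) (C : ℝ)
    (hP_nonneg : ∀ k, 0 ≤ P k)
    (hP_sum : ∑' k : ℕ, P k = 1)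
    (h0 : 1 * P 0 = (1 / 2) * P 1)
    (h1 : (9 / 4) * P 1 = P 2)
    (h2 : (7 / 2) * P 2 = (3 / 4) * P 1 + (3 / 2) * P 3)
    (hrec : ∀ k : ℕ, 3 ≤ k →
      (1 + (5 / 4) * k) * P k
        = (3 / 4) * ((k : ℝ) - 1) * P (k - 1) + (1 / 2) * ((k : ℝ) + 1) * P (k + 1)
          + (if k = 3 then 1 else 0))
    (hint : ∀ k : ℕ, 3 ≤ k →
      P k = C * ∫ z in (0:ℝ)..1, z ^ (k - 1) * (1 - z) ^ 4 / (3 / 2 - z) ^ 4) :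
    P 0 = 47 - (171 / 4) * Real.log 3 ∧
    C = 171 / 4 ∧
    P 1 = 94 - (171 / 2) * Real.log 3 ∧
    P 2 = 423 / 2 - (1539 / 8) * Real.log 3 ∧
    P 3 = (19 / 2) * (47 - (171 / 4) * Real.log 3) := by
  have hP3 := hint 3 le_rfl
  have hP4 := hint 4 (by norm_num)
  have hr := hrec 3 le_rfl
  norm_num only at hP3 hP4 hr
  rw [integral_sq_mul_one_sub_pow_four_div] at hP3
  rw [integral_cube_mul_one_sub_pow_four_div] at hP4
  simp only [if_true] at hr
  have hP2 : P 2 = 9 / 19 * P 3 := by linarith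
  have hC : C = 171 / 4 := by
    rw [hP2, hP3, hP4] at hr
    linarith
  rw [hC] at hP3
  refine ⟨?_, hC, ?_, ?_, ?_⟩ <;> linarith
end
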